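/- Let φ: ℝ → ℝ be a smooth even function with 0 ≤ φ ≤ 1, φ(x) = 1 for |x| ≤ 2, and φ(x) = 0 for |x| ≥ 4. For t > 0 define g_t(x) = (1 − φ(x/t))/x for x ≠ 0 and g_t(0) = 0. Then there exists a constant C > 0 (depending only on φ) such that for all x, y ∈ ℝ with |x| ≥ 2|y| and y ≠ 0: sup_{t>0} |g_t(x−y) − g_t(x)| ≤ C·|y|/|x−y|². -/

import Mathlib

open Real

/-- Hörmander-type smoothness estimate for the smoothly truncated Hilbert
kernels `g_t(x) = (1 − φ(x/t))/x`, uniformly in the truncation parameter `t > 0`. -/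
theorem smooth_trunc_kernel_hormander (φ : ℝ → ℝ)
    (hφ_smooth : ContDiff ℝ (⊤ : ℕ∞) φ)
    (hφ_even : ∀ x, φ (-x) = φ x)
    (hφ_nonneg : ∀ x, 0 ≤ φ x) (hφ_le_one : ∀ x, φ x ≤ 1)
    (hφ_one : ∀ x : ℝ, |x| ≤ 2 → φ x = 1)
    (hφ_zero : ∀ x : ℝ, 4 ≤ |x| → φ x = 0) :
    ∃ C : ℝ, 0 < C ∧
      ∀ (g : ℝ → ℝ → ℝ),
        (∀ t : ℝ, ∀ x : ℝ, x ≠ 0 → g t x = (1 - φ (x / t)) / x) →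
        (∀ t : ℝ, g t 0 = 0) →
        ∀ x y : ℝ, 2 * |y| ≤ |x| → y ≠ 0 →
          ∀ t : ℝ, 0 < t →
            |g t (x - y) - g t x| ≤ C * |y| / (x - y) ^ 2 := by
  have hsupp : HasCompactSupport φ := by
    refine HasCompactSupport.intro (isCompact_Icc : IsCompact (Set.Icc (-4 : ℝ) 4)) fun x hx => ?_
    refine hφ_zero x ?_
    by_contra! h
    exact hx (abs_le.mp h.le)
  obtain ⟨L, hL⟩ := hφ_smooth.lipschitzWith_of_hasCompactSupport hsupp (by simp)
  refine ⟨9 * L + 2, by positivity, fun g hg _ x y hxy hy t ht => ?_⟩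
  have hy0 : 0 < |y| := abs_pos.mpr hy
  have hx0 : 0 < |x| := by linarith
  have hu_ge : |x| ≤ |x - y| + |y| := by simpa using abs_add_le (x - y) y
  have hu_le : |x - y| ≤ |x| + |y| := abs_sub x y
  have hu0 : 0 < |x - y| := by linarith
  have hx : x ≠ 0 := abs_pos.mp hx0
  have hu : x - y ≠ 0 := abs_pos.mp hu0
  have hφ_diff : |φ (x / t) - φ ((x - y) / t)| * |x - y| ≤ 6 * L * |y| := by
    by_cases h : |x - y| ≤ 6 * t
    · have h1 : |φ (x / t) - φ ((x - y) / t)| ≤ L * (|y| / t) := by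
        have := hL.dist_le_mul (x / t) ((x - y) / t)
        rwa [Real.dist_eq, Real.dist_eq, ← sub_div, sub_sub_cancel, abs_div,
          abs_of_pos ht] at this
      calc _ ≤ L * (|y| / t) * (6 * t) := by gcongr
        _ = _ := by field_simp
    · push Not at h
      rw [hφ_zero (x / t), hφ_zero ((x - y) / t)]
      · simp only [sub_self, abs_zero, zero_mul]; positivity
      · rw [abs_div, abs_of_pos ht, le_div_iff₀ ht]; linarith
      · rw [abs_div, abs_of_pos ht, le_div_iff₀ ht]; linarith
  have hsplit : g t (x - y) - g t x = ((1 - φ ((x - y) / t)) * y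
      + (φ (x / t) - φ ((x - y) / t)) * (x - y)) / ((x - y) * x) := by
    rw [hg t _ hu, hg t _ hx]
    field_simp
    ring
  have hφ_term : |1 - φ ((x - y) / t)| ≤ 1 :=
    abs_le.mpr ⟨by linarith [hφ_le_one ((x - y) / t)], by linarith [hφ_nonneg ((x - y) / t)]⟩
  have hnum : |(1 - φ ((x - y) / t)) * y + (φ (x / t) - φ ((x - y) / t)) * (x - y)|
      ≤ (1 + 6 * L) * |y| := by
    refine (abs_add_le _ _).trans ?_
    rw [abs_mul, abs_mul]
    nlinarith
  have hden : (x - y) ^ 2 ≤ 3 / 2 * (|x - y| * |x|) := by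
    rw [← sq_abs]
    nlinarith
  rw [hsplit, abs_div, abs_mul (x - y) x, div_le_div_iff₀ (by positivity) (by positivity)]
  calc _ ≤ (1 + 6 * L) * |y| * (3 / 2 * (|x - y| * |x|)) := by gcongr
    _ = (9 * L + 3 / 2) * |y| * (|x - y| * |x|) := by ring
    _ ≤ _ := by gcongr; norm_num
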